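/- arXiv:2307.03013 — 5 statements merged into one kernel-verified Lean document; each statement's English description precedes it below -/
import Mathlib

section
/- Let 1 < p < 2 be a real number, let p' = p/(p−1) be the conjugate exponent, and let m ≥ 1. Then for all vectors ω₁, ω₂ ∈ ℝᵐ one has |(ω₁+ω₂)/2|^{p'} + |(ω₁−ω₂)/2|^{p'} ≤ [ (1/2)(|ω₁|^p + |ω₂|^p) ]^{1/(p−1)}, where |·| denotes the Euclidean norm on ℝᵐ. -/
theorem abs_mul_add_add_mul_sub_le_interp {a b c d p : ℝ} (ha : 0 ≤ a) (hb : 0 ≤ b) (hc : 0 ≤ c) (hd : 0 ≤ d)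
    (hp1 : 1 < p) (hp2 : p < 2) :
    |c * (a + b) + d * (a - b)| ≤
      ((a ^ p + b ^ p) * (c ^ p + d ^ p)) ^ (1 - 2 * (p - 1) / p) *
        √(2 * ((a ^ p + b ^ p) * (c ^ p + d ^ p))) ^ (2 * (p - 1) / p) := by
  let k : ℂ → ℂ := fun z => p * (1 - z / 2)
  have hkre : ∀ z : ℂ, (k z).re = p * (1 - z.re / 2) := fun z => by simp [k]
  have hkpos : ∀ z : ℂ, z.re ≤ 1 → 0 < (k z).re := fun z hz => by
    rw [hkre]; exact mul_pos (by linarith) (by linarith)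
  have hk0 : ∀ z : ℂ, z.re ≤ 1 → k z ≠ 0 := fun z hz h => by
    have := hkpos z hz; simp [h] at this
  have hkd : Differentiable ℂ k := by fun_prop
  have hnorm : ∀ x : ℝ, 0 ≤ x → ∀ z : ℂ, z.re ≤ 1 →
      ‖(x : ℂ) ^ k z‖ = x ^ (p * (1 - z.re / 2)) := fun x hx z hz => by
    rw [Complex.norm_cpow_eq_rpow_re_of_nonneg hx (hkpos z hz).ne', hkre]
  let F : ℂ → ℂ := fun z =>
    (c : ℂ) ^ k z * ((a : ℂ) ^ k z + (b : ℂ) ^ k z) +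
      (d : ℂ) ^ k z * ((a : ℂ) ^ k z - (b : ℂ) ^ k z)
  have hFd : DiffContOnCl ℂ F (Complex.HadamardThreeLines.verticalStrip 0 1) := by
    apply DifferentiableOn.diffContOnCl
    intro z hz
    have hz1 : z.re ≤ 1 := by
      have hcl : IsClosed {z : ℂ | z.re ≤ 1} := isClosed_le Complex.continuous_re continuous_const
      exact closure_minimal (fun (w : ℂ) hw => (hw.2.le : w.re ≤ 1)) hcl hz
    have h : ∀ x : ℝ, DifferentiableAt ℂ (fun z => (x : ℂ) ^ k z) z := fun x =>
      (hkd z).const_cpow (Or.inr (hk0 z hz1))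
    exact (((h c).mul ((h a).add (h b))).add
      ((h d).mul ((h a).sub (h b)))).differentiableWithinAt
  have htri : ∀ u v x y : ℂ, ‖u * (x + y) + v * (x - y)‖ ≤ (‖x‖ + ‖y‖) * (‖u‖ + ‖v‖) := by
    intro u v x y
    calc _ ≤ ‖u * (x + y)‖ + ‖v * (x - y)‖ := norm_add_le _ _
      _ = ‖u‖ * ‖x + y‖ + ‖v‖ * ‖x - y‖ := by simp
      _ ≤ ‖u‖ * (‖x‖ + ‖y‖) + ‖v‖ * (‖x‖ + ‖y‖) := by
        gcongr
        · exact norm_add_le _ _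
        · exact norm_sub_le _ _
      _ = _ := by ring
  have hcs : ∀ u v x y : ℂ, ‖u * (x + y) + v * (x - y)‖ ≤
      √(2 * ((‖x‖ ^ 2 + ‖y‖ ^ 2) * (‖u‖ ^ 2 + ‖v‖ ^ 2))) := by
    intro u v x y
    apply Real.le_sqrt_of_sq_le
    have h1 : ‖u * (x + y) + v * (x - y)‖ ≤ ‖u‖ * ‖x + y‖ + ‖v‖ * ‖x - y‖ := by
      simpa using norm_add_le (u * (x + y)) (v * (x - y))
    have h2 := parallelogram_law_with_norm ℂ x y
    calc _ ≤ (‖u‖ * ‖x + y‖ + ‖v‖ * ‖x - y‖) ^ 2 := by gcongr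
      _ ≤ (‖x + y‖ ^ 2 + ‖x - y‖ ^ 2) * (‖u‖ ^ 2 + ‖v‖ ^ 2) := by
        nlinarith [sq_nonneg (‖u‖ * ‖x - y‖ - ‖v‖ * ‖x + y‖)]
      _ = _ := by rw [h2]; ring
  have hB : BddAbove ((norm ∘ F) '' Complex.HadamardThreeLines.verticalClosedStrip 0 1) := by
    have hx : ∀ x : ℝ, 0 ≤ x → ∀ z ∈ Complex.HadamardThreeLines.verticalClosedStrip 0 1,
        ‖(x : ℂ) ^ k z‖ ≤ (max x 1) ^ p := by
      intro x hx z hz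
      rw [hnorm x hx z hz.2]
      have h0 : 0 ≤ z.re := hz.1
      have h1 : z.re ≤ 1 := hz.2
      calc _ ≤ (max x 1) ^ (p * (1 - z.re / 2)) :=
            Real.rpow_le_rpow hx (le_max_left _ _) (by nlinarith)
        _ ≤ _ := Real.rpow_le_rpow_of_exponent_le (le_max_right _ _) (by nlinarith)
    refine ⟨(max a 1 ^ p + max b 1 ^ p) * (max c 1 ^ p + max d 1 ^ p), ?_⟩
    rintro _ ⟨z, hz, rfl⟩
    refine (htri _ _ _ _).trans ?_
    gcongr
    exacts [hx a ha z hz, hx b hb z hz, hx c hc z hz, hx d hd z hz]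
  have h0 : ∀ z ∈ Complex.re ⁻¹' {(0 : ℝ)},
      ‖F z‖ ≤ (a ^ p + b ^ p) * (c ^ p + d ^ p) := by
    intro z hz
    have hz : z.re = 0 := hz
    have hx : ∀ x : ℝ, 0 ≤ x → ‖(x : ℂ) ^ k z‖ = x ^ p := fun x hx => by
      rw [hnorm x hx z (by linarith), hz]; simp
    have := htri ((c : ℂ) ^ k z) ((d : ℂ) ^ k z) ((a : ℂ) ^ k z) ((b : ℂ) ^ k z)
    rwa [hx a ha, hx b hb, hx c hc, hx d hd] at this
  have h1 : ∀ z ∈ Complex.re ⁻¹' {(1 : ℝ)},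
      ‖F z‖ ≤ √(2 * ((a ^ p + b ^ p) * (c ^ p + d ^ p))) := by
    intro z hz
    have hz : z.re = 1 := hz
    have hx : ∀ x : ℝ, 0 ≤ x → ‖(x : ℂ) ^ k z‖ ^ 2 = x ^ p := fun x hx => by
      rw [hnorm x hx z hz.le, hz, ← Real.rpow_mul_natCast hx]
      congr 1; push_cast; ring
    have := hcs ((c : ℂ) ^ k z) ((d : ℂ) ^ k z) ((a : ℂ) ^ k z) ((b : ℂ) ^ k z)
    rwa [hx a ha, hx b hb, hx c hc, hx d hd] at this
  have hp0 : 0 < p := by linarith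
  have hmem : ((2 * (p - 1) / p : ℝ) : ℂ) ∈
      Complex.HadamardThreeLines.verticalClosedStrip 0 1 := by
    constructor
    · exact div_nonneg (by linarith) hp0.le
    · rw [Complex.ofReal_re, div_le_one hp0]; linarith
  have hk1 : k ((2 * (p - 1) / p : ℝ) : ℂ) = 1 := by
    have : (p : ℂ) ≠ 0 := by exact_mod_cast hp0.ne'
    simp only [k]; push_cast; field_simp; ring
  have key := Complex.HadamardThreeLines.norm_le_interp_of_mem_verticalClosedStrip'
    one_pos hmem hFd hB h0 h1
  simp only [F, hk1, Complex.cpow_one, Complex.ofReal_re, sub_zero, div_one] at key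
  rw [← Real.norm_eq_abs, ← Complex.norm_real]
  push_cast at key ⊢
  exact key

theorem add_rpow_add_abs_sub_rpow_le {a b p : ℝ} (ha : 0 ≤ a) (hb : 0 ≤ b)
    (hp1 : 1 < p) (hp2 : p < 2) :
    (a + b) ^ (p / (p - 1)) + |a - b| ^ (p / (p - 1)) ≤
      2 * (a ^ p + b ^ p) ^ (1 / (p - 1)) := by
  wlog hab : b ≤ a generalizing a b
  · have := this hb ha (not_le.mp hab).le
    rwa [add_comm a, abs_sub_comm, add_comm (a ^ p)]
  have hp0 : 0 < p := by linarith
  have hr : 0 < p - 1 := by linarith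
  have hB : 0 ≤ a - b := by linarith
  have hA : 0 ≤ a + b := by linarith
  rw [abs_of_nonneg hB]
  have key := abs_mul_add_add_mul_sub_le_interp ha hb (Real.rpow_nonneg hA (1 / (p - 1)))
    (Real.rpow_nonneg hB (1 / (p - 1))) hp1 hp2
  have e1 : ∀ x : ℝ, 0 ≤ x → x ^ (1 / (p - 1)) * x = x ^ (p / (p - 1)) := fun x hx => by
    have h : p / (p - 1) = 1 / (p - 1) + 1 := by field_simp; ring
    rw [h, Real.rpow_add_one' hx (by positivity)]
  have e2 : ∀ x : ℝ, 0 ≤ x → (x ^ (1 / (p - 1))) ^ p = x ^ (p / (p - 1)) := fun x hx => by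
    rw [← Real.rpow_mul hx]; congr 1; ring
  rw [e1 _ hA, e1 _ hB, e2 _ hA, e2 _ hB] at key
  set S := a ^ p + b ^ p
  set R := (a + b) ^ (p / (p - 1)) + (a - b) ^ (p / (p - 1))
  have hS : 0 ≤ S := by positivity
  have hR : 0 ≤ R := by positivity
  rcases hR.eq_or_lt with h | hRpos
  · rw [← h]; positivity
  replace key := (le_abs_self R).trans key
  rcases hS.eq_or_lt with h | hSpos
  · rw [← h] at key
    have : 2 * (p - 1) / p ≠ 0 := by positivity
    simp [Real.zero_rpow this] at key
    linarith
  have hlog := Real.log_le_log hRpos key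
  rw [Real.log_mul (by positivity) (by positivity), Real.log_rpow (by positivity),
    Real.log_rpow (by positivity), Real.log_sqrt (by positivity),
    Real.log_mul two_ne_zero (by positivity), Real.log_mul hSpos.ne' hRpos.ne'] at hlog
  rw [← Real.log_le_log_iff hRpos (by positivity), Real.log_mul two_ne_zero (by positivity),
    Real.log_rpow hSpos]
  have h2 : (p - 1) * Real.log R ≤ (p - 1) * Real.log 2 + Real.log S := by
    have := mul_le_mul_of_nonneg_left hlog hp0.le
    field_simp at this
    linarith
  have h3 : Real.log R ≤ ((p - 1) * Real.log 2 + Real.log S) / (p - 1) := by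
    rw [le_div_iff₀ hr]; linarith
  refine h3.trans_eq ?_
  field_simp

theorem ConvexOn.add_le_add_of_abs_le {f : ℝ → ℝ} {K : Set ℝ} (hf : ConvexOn ℝ K f) {s t T : ℝ}
    (h : |t| ≤ T) (h₁ : s + T ∈ K) (h₂ : s - T ∈ K) :
    f (s + t) + f (s - t) ≤ f (s + T) + f (s - T) := by
  rcases ((abs_nonneg t).trans h).eq_or_lt with rfl | hT
  · rw [abs_nonpos_iff.mp h]
  obtain ⟨hl, hu⟩ := abs_le.mp h
  have hα : 0 ≤ (T + t) / (2 * T) := div_nonneg (by linarith) (by linarith)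
  have hβ : 0 ≤ (T - t) / (2 * T) := div_nonneg (by linarith) (by linarith)
  have hs : (T + t) / (2 * T) + (T - t) / (2 * T) = 1 := by field_simp; ring
  have p1 := hf.2 h₁ h₂ hα hβ hs
  have p2 := hf.2 h₁ h₂ hβ hα (by linarith)
  simp only [smul_eq_mul] at p1 p2
  have q1 : (T + t) / (2 * T) * (s + T) + (T - t) / (2 * T) * (s - T) = s + t := by
    field_simp; ring
  have q2 : (T - t) / (2 * T) * (s + T) + (T + t) / (2 * T) * (s - T) = s - t := by
    field_simp; ring
  rw [q1] at p1
  rw [q2] at p2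
  calc _ ≤ _ := add_le_add p1 p2
    _ = ((T + t) / (2 * T) + (T - t) / (2 * T)) * (f (s + T) + f (s - T)) := by ring
    _ = _ := by rw [hs, one_mul]

theorem norm_add_rpow_add_norm_sub_rpow_le {E : Type*} [NormedAddCommGroup E]
    [InnerProductSpace ℝ E] (x y : E) {q : ℝ} (hq : 2 ≤ q) :
    ‖x + y‖ ^ q + ‖x - y‖ ^ q ≤ (‖x‖ + ‖y‖) ^ q + |‖x‖ - ‖y‖| ^ q := by
  have e : ∀ r : ℝ, 0 ≤ r → r ^ q = (r ^ 2) ^ (q / 2) := fun r hr => by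
    rw [← Real.rpow_natCast_mul hr]; congr 1; push_cast; ring
  rw [e _ (norm_nonneg _), e _ (norm_nonneg _), e _ (abs_nonneg _), e _ (by positivity), sq_abs,
    norm_add_sq_real, norm_sub_sq_real]
  have h : |2 * inner ℝ x y| ≤ 2 * (‖x‖ * ‖y‖) := by
    rw [abs_mul, abs_two]
    exact mul_le_mul_of_nonneg_left (abs_real_inner_le_norm x y) two_pos.le
  have := (convexOn_rpow (p := q / 2) (by linarith)).add_le_add_of_abs_le
    (s := ‖x‖ ^ 2 + ‖y‖ ^ 2) h (Set.mem_Ici.mpr (by positivity))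
    (Set.mem_Ici.mpr (by nlinarith [sq_nonneg (‖x‖ - ‖y‖)]))
  convert this using 3 <;> ring

theorem clarkson_type_inequality_p_lt_two
    (p p' : ℝ) (hp1 : 1 < p) (hp2 : p < 2) (hp' : p' = p / (p - 1))
    (m : ℕ) (hm : 1 ≤ m)
    (ω₁ ω₂ : EuclideanSpace ℝ (Fin m)) :
    ‖((1 : ℝ) / 2) • (ω₁ + ω₂)‖ ^ p' + ‖((1 : ℝ) / 2) • (ω₁ - ω₂)‖ ^ p'
      ≤ ((1 / 2) * (‖ω₁‖ ^ p + ‖ω₂‖ ^ p)) ^ (1 / (p - 1)) := by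
  have hr : 0 < p - 1 := by linarith
  have hq : 2 ≤ p' := by rw [hp', le_div_iff₀ hr]; linarith
  have h := (norm_add_rpow_add_norm_sub_rpow_le ω₁ ω₂ hq).trans
    (hp' ▸ add_rpow_add_abs_sub_rpow_le (norm_nonneg ω₁) (norm_nonneg ω₂) hp1 hp2)
  have hhalf : ((1 : ℝ) / 2) ^ (1 / (p - 1)) = (1 / 2) ^ p' * 2 := by
    have : p' = 1 / (p - 1) + 1 := by rw [hp']; field_simp; ring
    rw [this, Real.rpow_add_one (by norm_num)]; ring
  rw [norm_smul, norm_smul, Real.norm_of_nonneg (by norm_num : (0 : ℝ) ≤ 1 / 2),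
    Real.mul_rpow (by norm_num) (norm_nonneg _), Real.mul_rpow (by norm_num) (norm_nonneg _),
    Real.mul_rpow (by norm_num) (by positivity), hhalf, ← mul_add, mul_assoc]
  gcongr
end

section
/- Let 1 < p ≤ 2 and m ≥ 1. There exists a constant C = C(p) > 0 such that for all ω₁, ω₂ ∈ ℝᵐ with (ω₁, ω₂) ≠ (0, 0) one has ( |ω₁|^{p−2} ω₁ − |ω₂|^{p−2} ω₂ ) · (ω₁ − ω₂) ≥ C |ω₁ − ω₂|² / (|ω₁| + |ω₂|)^{2−p}, where · is the Euclidean inner product, |·| the Euclidean norm on ℝᵐ, and |ω|^{p−2}ω is interpreted as 0 when ω = 0. -/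
open scoped RealInnerProductSpace

/-- The tangent line inequality for the concave function `x ↦ x ^ (p - 1)`. -/
theorem rpow_sub_two_mul_self_le_tangent {p a b : ℝ} (hp1 : 1 < p) (hp2 : p ≤ 2)
    (ha : 0 < a) (hb : 0 < b) :
    b ^ (p - 2) * b ≤ a ^ (p - 2) * a + (p - 1) * a ^ (p - 2) * (b - a) := by
  have h := rpow_one_add_le_one_add_mul_self (s := b / a - 1) (p := p - 1)
    (by linarith [div_pos hb ha]) (by linarith) (by linarith)
  have hpow : ∀ c : ℝ, 0 < c → c ^ (p - 1) = c ^ (p - 2) * c := fun c hc => by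
    rw [← Real.rpow_add_one hc.ne']
    ring_nf
  rw [add_sub_cancel, Real.div_rpow hb.le ha.le, hpow a ha, hpow b hb] at h
  have hs : 0 < a ^ (p - 2) := Real.rpow_pos_of_pos ha _
  rw [div_le_iff₀ (mul_pos hs ha)] at h
  calc b ^ (p - 2) * b ≤ (1 + (p - 1) * (b / a - 1)) * (a ^ (p - 2) * a) := h
    _ = _ := by field_simp

/-- The one-dimensional strong monotonicity estimate on the positive half-line. -/
theorem rpow_sub_two_mul_self_strong_mono {p a b : ℝ} (hp1 : 1 < p) (hp2 : p ≤ 2)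
    (ha : 0 < a) (hb : 0 < b) :
    (p - 1) * (a + b) ^ (p - 2) * (a - b) ^ 2
      ≤ (a ^ (p - 2) * a - b ^ (p - 2) * b) * (a - b) := by
  wlog hab : b ≤ a generalizing a b
  · have h := this hb ha (le_of_not_ge hab)
    rw [add_comm b a] at h
    linarith
  have h := rpow_sub_two_mul_self_le_tangent hp1 hp2 ha hb
  have hK : (a + b) ^ (p - 2) ≤ a ^ (p - 2) :=
    Real.rpow_le_rpow_of_nonpos ha (by linarith) (by linarith)
  have hd : 0 ≤ a - b := sub_nonneg.2 hab
  calc (p - 1) * (a + b) ^ (p - 2) * (a - b) ^ 2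
      ≤ (p - 1) * a ^ (p - 2) * (a - b) ^ 2 := by
        have : 0 ≤ p - 1 := by linarith
        gcongr
    _ = (p - 1) * a ^ (p - 2) * (a - b) * (a - b) := by ring
    _ ≤ _ := mul_le_mul_of_nonneg_right (by linarith) hd

/-- Strong monotonicity of `ω ↦ |ω| ^ (p - 2) ω` with explicit constant `p - 1`. -/
theorem norm_rpow_sub_two_smul_strong_mono {E : Type*} [NormedAddCommGroup E]
    [InnerProductSpace ℝ E] {p : ℝ} (hp1 : 1 < p) (hp2 : p ≤ 2) (u v : E) :
    (p - 1) * (‖u‖ + ‖v‖) ^ (p - 2) * ‖u - v‖ ^ 2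
      ≤ ⟪(‖u‖ ^ (p - 2)) • u - (‖v‖ ^ (p - 2)) • v, u - v⟫ := by
  have hz : ∀ w : E, (p - 1) * ‖w‖ ^ (p - 2) * ‖w‖ ^ 2 ≤ ‖w‖ ^ (p - 2) * ‖w‖ ^ 2 := fun w => by
    have : 0 ≤ ‖w‖ ^ (p - 2) * ‖w‖ ^ 2 := by positivity
    nlinarith
  rcases eq_or_ne u 0 with rfl | hu
  · simpa [inner_smul_left] using hz v
  rcases eq_or_ne v 0 with rfl | hv
  · simpa [inner_smul_left] using hz u
  have ha : 0 < ‖u‖ := norm_pos_iff.2 hu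
  have hb : 0 < ‖v‖ := norm_pos_iff.2 hv
  have key := rpow_sub_two_mul_self_strong_mono hp1 hp2 ha hb
  have hx : ⟪u, v⟫ ≤ ‖u‖ * ‖v‖ := real_inner_le_norm u v
  have hKa : (‖u‖ + ‖v‖) ^ (p - 2) ≤ ‖u‖ ^ (p - 2) :=
    Real.rpow_le_rpow_of_nonpos ha (by linarith) (by linarith)
  have hKb : (‖u‖ + ‖v‖) ^ (p - 2) ≤ ‖v‖ ^ (p - 2) :=
    Real.rpow_le_rpow_of_nonpos hb (by linarith) (by linarith)
  have hK : 0 ≤ (‖u‖ + ‖v‖) ^ (p - 2) := by positivity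
  have hexp : ⟪(‖u‖ ^ (p - 2)) • u - (‖v‖ ^ (p - 2)) • v, u - v⟫
      = ‖u‖ ^ (p - 2) * ‖u‖ ^ 2 + ‖v‖ ^ (p - 2) * ‖v‖ ^ 2
        - (‖u‖ ^ (p - 2) + ‖v‖ ^ (p - 2)) * ⟪u, v⟫ := by
    simp only [inner_sub_left, inner_sub_right, real_inner_smul_left,
      real_inner_self_eq_norm_sq, real_inner_comm u v]
    ring
  rw [hexp, norm_sub_sq_real]
  have hcoef : 0 ≤ ‖u‖ ^ (p - 2) + ‖v‖ ^ (p - 2)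
      - 2 * ((p - 1) * (‖u‖ + ‖v‖) ^ (p - 2)) := by
    nlinarith [mul_nonneg (sub_nonneg.2 hp2) hK]
  linarith [mul_nonneg hcoef (sub_nonneg.2 hx)]

theorem strong_monotonicity_of_p_power_map_p_le_two
    (p : ℝ) (hp1 : 1 < p) (hp2 : p ≤ 2) (m : ℕ) (hm : 1 ≤ m) :
    ∃ C : ℝ, 0 < C ∧ ∀ ω₁ ω₂ : EuclideanSpace ℝ (Fin m), ¬(ω₁ = 0 ∧ ω₂ = 0) →
      ⟪(‖ω₁‖ ^ (p - 2)) • ω₁ - (‖ω₂‖ ^ (p - 2)) • ω₂, ω₁ - ω₂⟫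
        ≥ C * ‖ω₁ - ω₂‖ ^ (2 : ℝ) / (‖ω₁‖ + ‖ω₂‖) ^ (2 - p) := by
  refine ⟨p - 1, by linarith, fun ω₁ ω₂ _ => ?_⟩
  have h := norm_rpow_sub_two_smul_strong_mono hp1 hp2 ω₁ ω₂
  rw [← neg_sub 2 p, Real.rpow_neg (by positivity)] at h
  rw [neg_sub] at h
  rw [ge_iff_le, Real.rpow_two, div_eq_mul_inv]
  linarith
end

section
/- Let Ω ⊂ ℝ^d be a bounded open set with Lebesgue measure, let 1 < p < 2, let p' = p/(p−1), let m ≥ 1, and let f, g : Ω → ℝᵐ be measurable with ‖f‖_p < ∞ and ‖g‖_p < ∞. Then ‖(f+g)/2‖_p^{p'} + ‖(f−g)/2‖_p^{p'} ≤ [ (1/2) ‖f‖_p^p + (1/2) ‖g‖_p^p ]^{1/(p−1)}. -/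
open MeasureTheory

theorem antitoneOn_friedrichs {q z : ℝ} (hq : 2 ≤ q) (hz0 : 0 ≤ z) (hz1 : z < 1) :
    AntitoneOn (fun α : ℝ ↦ (1 + α ^ (1 - q) * z) * (1 + α * z) ^ (q - 1)
      + (1 - α ^ (1 - q) * z) * (1 - α * z) ^ (q - 1)) (Set.Ioc 0 1) := by
  have key : ∀ α ∈ Set.Ioc (0 : ℝ) 1, HasDerivAt
      (fun α : ℝ ↦ (1 + α ^ (1 - q) * z) * (1 + α * z) ^ (q - 1)
        + (1 - α ^ (1 - q) * z) * (1 - α * z) ^ (q - 1))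
      ((q - 1) * z * ((1 - α ^ (-q)) * ((1 + α * z) ^ (q - 2) - (1 - α * z) ^ (q - 2)))) α := by
    rintro α ⟨h0, h1⟩
    have hm : 0 < 1 - α * z := by nlinarith
    have hp : 0 < 1 + α * z := by positivity
    have d1 : HasDerivAt (fun α : ℝ ↦ α ^ (1 - q) * z) ((1 - q) * α ^ (-q) * z) α := by
      have := (Real.hasDerivAt_rpow_const (p := 1 - q) (Or.inl h0.ne')).mul_const z
      rwa [show 1 - q - 1 = -q by ring] at this
    have d2 : HasDerivAt (fun α : ℝ ↦ α * z) z α := hasDerivAt_mul_const z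
    have d3 := (d2.const_add 1).rpow_const (p := q - 1) (Or.inl hp.ne')
    have d4 := (d2.const_sub 1).rpow_const (p := q - 1) (Or.inl hm.ne')
    have d := ((d1.const_add 1).mul d3).add ((d1.const_sub 1).mul d4)
    refine d.congr_deriv ?_
    have e1 : (1 + α * z) ^ (q - 1) = (1 + α * z) ^ (q - 2) * (1 + α * z) := by
      rw [← Real.rpow_add_one hp.ne']; ring_nf
    have e2 : (1 - α * z) ^ (q - 1) = (1 - α * z) ^ (q - 2) * (1 - α * z) := by
      rw [← Real.rpow_add_one hm.ne']; ring_nf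
    have e3 : α ^ (1 - q) = α ^ (-q) * α := by
      rw [← Real.rpow_add_one h0.ne']; ring_nf
    rw [show q - 1 - 1 = q - 2 by ring, e1, e2, e3]
    ring
  refine antitoneOn_of_deriv_nonpos (convex_Ioc 0 1)
    (fun α hα ↦ (key α hα).continuousAt.continuousWithinAt) ?_ ?_
  · intro α hα
    exact (key α (interior_subset hα)).differentiableAt.differentiableWithinAt
  · intro α hα
    have hα := interior_subset hα
    rw [(key α hα).deriv]
    obtain ⟨h0, h1⟩ := hα
    have hm : 0 ≤ 1 - α * z := by nlinarith
    have hαz : 0 ≤ α * z := by positivity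
    have i1 : 1 ≤ α ^ (-q) := Real.one_le_rpow_of_pos_of_le_one_of_nonpos h0 h1 (by linarith)
    have i2 : (1 - α * z) ^ (q - 2) ≤ (1 + α * z) ^ (q - 2) :=
      Real.rpow_le_rpow hm (by linarith) (by linarith)
    exact mul_nonpos_of_nonneg_of_nonpos (mul_nonneg (by linarith) hz0)
      (mul_nonpos_of_nonpos_of_nonneg (by linarith) (by linarith))

theorem clarkson_one_of_mem_Icc {p q z : ℝ} (hpq : p.HolderConjugate q) (hq : 2 ≤ q)
    (hz0 : 0 ≤ z) (hz1 : z ≤ 1) :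
    (1 + z) ^ q + (1 - z) ^ q ≤ 2 * (1 + z ^ p) ^ (q - 1) := by
  have hp := hpq.lt
  have hpq1 : (p - 1) * (q - 1) = 1 := by linarith [hpq.mul_eq_add]
  rcases hz0.eq_or_lt with rfl | hz0
  · simp [Real.zero_rpow hpq.ne_zero]; norm_num
  rcases hz1.eq_or_lt with rfl | hz1
  · simp [Real.zero_rpow hpq.symm.ne_zero]
    norm_num
    rw [← Real.rpow_one_add' (by norm_num) (by linarith)]
    simp
  have h := antitoneOn_friedrichs hq hz0.le hz1
    (a := z ^ (p - 1)) (b := 1)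
    ⟨by positivity, Real.rpow_le_one hz0.le hz1.le (by linarith)⟩ (by simp)
    (Real.rpow_le_one hz0.le hz1.le (by linarith))
  have e1 : (z ^ (p - 1)) ^ (1 - q) * z = 1 := by
    rw [← Real.rpow_mul hz0.le, show (p - 1) * (1 - q) = -1 by linarith, Real.rpow_neg_one,
      inv_mul_cancel₀ hz0.ne']
  have e2 : z ^ (p - 1) * z = z ^ p := by
    rw [← Real.rpow_add_one hz0.ne']; ring_nf
  simp only [e1, e2, Real.one_rpow, one_mul] at h
  rw [← Real.rpow_one_add' (by linarith) (by linarith),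
    ← Real.rpow_one_add' (by linarith) (by linarith)] at h
  simp only [add_sub_cancel] at h
  linarith

theorem clarkson_of_nonneg_of_le {p q a b : ℝ} (hpq : p.HolderConjugate q) (hq : 2 ≤ q)
    (hb : 0 ≤ b) (hab : b ≤ a) :
    ((a + b) / 2) ^ q + ((a - b) / 2) ^ q ≤ (1 / 2 * a ^ p + 1 / 2 * b ^ p) ^ (q - 1) := by
  have hp := hpq.lt
  rcases (hb.trans hab).eq_or_lt with rfl | ha
  · obtain rfl : b = 0 := le_antisymm hab hb
    simp [Real.zero_rpow hpq.ne_zero, Real.zero_rpow hpq.symm.ne_zero,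
      Real.zero_rpow (show q - 1 ≠ 0 by linarith)]
  obtain ⟨z, rfl⟩ : ∃ z, b = a * z := ⟨b / a, by field_simp⟩
  have hz0 : 0 ≤ z := nonneg_of_mul_nonneg_right hb ha
  have hz1 : z ≤ 1 := by nlinarith
  have h := clarkson_one_of_mem_Icc hpq hq hz0 hz1
  have hz1' : 0 ≤ 1 - z := by linarith
  have e1 : (a ^ p) ^ (q - 1) = a ^ q := by
    rw [← Real.rpow_mul ha.le]
    congr 1
    linarith [hpq.mul_eq_add]
  have e2 : (2 : ℝ) ^ q = 2 * 2 ^ (q - 1) := by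
    rw [← Real.rpow_one_add' (by norm_num) (by linarith)]; ring_nf
  rw [show (a + a * z) / 2 = a * (1 + z) / 2 by ring,
    show (a - a * z) / 2 = a * (1 - z) / 2 by ring, Real.mul_rpow ha.le hz0,
    show 1 / 2 * a ^ p + 1 / 2 * (a ^ p * z ^ p) = a ^ p * (1 + z ^ p) / 2 by ring,
    Real.div_rpow (by positivity) (by positivity), Real.div_rpow (by positivity) (by positivity),
    Real.div_rpow (by positivity) (by positivity), Real.mul_rpow ha.le (by positivity),
    Real.mul_rpow ha.le hz1', Real.mul_rpow (by positivity) (by positivity), e1, e2, ← add_div,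
    div_le_div_iff₀ (by positivity) (by positivity)]
  have : 0 ≤ a ^ q * 2 ^ (q - 1) := by positivity
  nlinarith [mul_le_mul_of_nonneg_left h this]

theorem rpow_add_add_rpow_sub_le {s c D r : ℝ} (hr : 1 ≤ r) (hc : |c| ≤ D) (hD : D ≤ s) :
    (s + c) ^ r + (s - c) ^ r ≤ (s + D) ^ r + (s - D) ^ r := by
  obtain ⟨h1, h2⟩ := abs_le.1 hc
  rcases ((abs_nonneg c).trans hc).eq_or_lt with rfl | hD0
  · obtain rfl : c = 0 := by linarith
    rfl
  have hconv := (convexOn_rpow hr).2 (x := s + D) (y := s - D)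
    (by simp; linarith) (by simp; linarith)
  have e1 := hconv (a := (D + c) / (2 * D)) (b := (D - c) / (2 * D))
    (div_nonneg (by linarith) (by linarith)) (div_nonneg (by linarith) (by linarith))
    (by field_simp; ring)
  have e2 := hconv (a := (D - c) / (2 * D)) (b := (D + c) / (2 * D))
    (div_nonneg (by linarith) (by linarith)) (div_nonneg (by linarith) (by linarith))
    (by field_simp; ring)
  simp only [smul_eq_mul] at e1 e2
  rw [show (D + c) / (2 * D) * (s + D) + (D - c) / (2 * D) * (s - D) = s + c by
    field_simp; ring] at e1
  rw [show (D - c) / (2 * D) * (s + D) + (D + c) / (2 * D) * (s - D) = s - c by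
    field_simp; ring] at e2
  have e3 : (D + c) / (2 * D) + (D - c) / (2 * D) = 1 := by field_simp; ring
  calc _ ≤ ((D + c) / (2 * D) + (D - c) / (2 * D)) * (s + D) ^ r
        + ((D + c) / (2 * D) + (D - c) / (2 * D)) * (s - D) ^ r := by linarith
    _ = _ := by rw [e3]; ring

theorem clarkson_norm {E : Type*} [NormedAddCommGroup E] [InnerProductSpace ℝ E] {p q : ℝ}
    (hpq : p.HolderConjugate q) (hq : 2 ≤ q) (u v : E) :
    ‖((1 : ℝ) / 2) • (u + v)‖ ^ q + ‖((1 : ℝ) / 2) • (u - v)‖ ^ q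
      ≤ (1 / 2 * ‖u‖ ^ p + 1 / 2 * ‖v‖ ^ p) ^ (q - 1) := by
  wlog h : ‖v‖ ≤ ‖u‖ generalizing u v
  · have := this v u (by linarith)
    rwa [add_comm v u, ← neg_sub u v, smul_neg, norm_neg, add_comm (1 / 2 * ‖v‖ ^ p)] at this
  refine le_trans ?_ (clarkson_of_nonneg_of_le hpq hq (norm_nonneg v) h)
  have sq_rpow : ∀ x : ℝ, 0 ≤ x → x ^ q = (x ^ 2) ^ (q / 2) := fun x hx ↦ by
    rw [← Real.rpow_natCast, ← Real.rpow_mul hx]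
    congr 1
    push_cast
    ring
  have e1 : ‖((1 : ℝ) / 2) • (u + v)‖ ^ 2
      = (‖u‖ ^ 2 + ‖v‖ ^ 2) / 4 + inner ℝ u v / 2 := by
    rw [norm_smul, mul_pow, norm_add_sq_real, Real.norm_eq_abs, sq_abs]; ring
  have e2 : ‖((1 : ℝ) / 2) • (u - v)‖ ^ 2
      = (‖u‖ ^ 2 + ‖v‖ ^ 2) / 4 - inner ℝ u v / 2 := by
    rw [norm_smul, mul_pow, norm_sub_sq_real, Real.norm_eq_abs, sq_abs]; ring
  rw [sq_rpow _ (norm_nonneg _), sq_rpow _ (norm_nonneg _), e1, e2,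
    sq_rpow ((‖u‖ + ‖v‖) / 2) (by positivity), sq_rpow ((‖u‖ - ‖v‖) / 2) (by linarith),
    show ((‖u‖ + ‖v‖) / 2) ^ 2 = (‖u‖ ^ 2 + ‖v‖ ^ 2) / 4 + ‖u‖ * ‖v‖ / 2 by ring,
    show ((‖u‖ - ‖v‖) / 2) ^ 2 = (‖u‖ ^ 2 + ‖v‖ ^ 2) / 4 - ‖u‖ * ‖v‖ / 2 by ring]
  refine rpow_add_add_rpow_sub_le (by linarith) ?_ (by nlinarith [sq_nonneg (‖u‖ - ‖v‖)])
  rw [abs_div, abs_two]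
  linarith [abs_real_inner_le_norm u v]

theorem rpow_integral_add_rpow_integral_le {X : Type*} [MeasurableSpace X] {μ : Measure X}
    {φ ψ : X → ℝ} {r : ℝ} (hr : 1 ≤ r) (hφ : Integrable φ μ) (hψ : Integrable ψ μ)
    (hφ0 : 0 ≤ φ) (hψ0 : 0 ≤ ψ) :
    ((∫ x, φ x ∂μ) ^ r + (∫ x, ψ x ∂μ) ^ r) ^ (1 / r)
      ≤ ∫ x, (φ x ^ r + ψ x ^ r) ^ (1 / r) ∂μ := by
  have : Fact (1 ≤ ENNReal.ofReal r) := ⟨by simpa using hr⟩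
  have hr' : (ENNReal.ofReal r).toReal = r := ENNReal.toReal_ofReal (by linarith)
  let L := (WithLp.prodContinuousLinearEquiv (ENNReal.ofReal r) ℝ ℝ ℝ).symm
  have hL : ∀ y : ℝ × ℝ, 0 ≤ y.1 → 0 ≤ y.2 → ‖L y‖ = (y.1 ^ r + y.2 ^ r) ^ (1 / r) := by
    intro y h1 h2
    rw [WithLp.prod_norm_eq_add (by rw [hr']; linarith), hr']
    simp [L, abs_of_nonneg h1, abs_of_nonneg h2]
  have h := norm_integral_le_integral_norm (μ := μ) fun x ↦ L (φ x, ψ x)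
  rw [L.integral_comp_comm, integral_pair hφ hψ,
    hL _ (integral_nonneg hφ0) (integral_nonneg hψ0)] at h
  exact h.trans_eq (integral_congr_ae (.of_forall fun x ↦ hL _ (hφ0 x) (hψ0 x)))

theorem integral_clarkson_type_inequality_p_lt_two
    (d m : ℕ) (hd : 1 ≤ d) (hm : 1 ≤ m)
    (Ω : Set (EuclideanSpace ℝ (Fin d))) (hΩo : IsOpen Ω) (hΩb : Bornology.IsBounded Ω)
    (p p' : ℝ) (hp1 : 1 < p) (hp2 : p < 2) (hp' : p' = p / (p - 1))
    (f g : EuclideanSpace ℝ (Fin d) → EuclideanSpace ℝ (Fin m))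
    (hf : Measurable f) (hg : Measurable g)
    (hfi : Integrable (fun x => ‖f x‖ ^ p) (volume.restrict Ω))
    (hgi : Integrable (fun x => ‖g x‖ ^ p) (volume.restrict Ω)) :
    ((∫ x in Ω, ‖((1 : ℝ) / 2) • (f x + g x)‖ ^ p) ^ (1 / p)) ^ p'
        + ((∫ x in Ω, ‖((1 : ℝ) / 2) • (f x - g x)‖ ^ p) ^ (1 / p)) ^ p'
      ≤ ((1 / 2) * ((∫ x in Ω, ‖f x‖ ^ p) ^ (1 / p)) ^ p
          + (1 / 2) * ((∫ x in Ω, ‖g x‖ ^ p) ^ (1 / p)) ^ p) ^ (1 / (p - 1)) := by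
  have hp0 : 0 < p := by linarith
  have hp10 : 0 < p - 1 := by linarith
  have hpq : p.HolderConjugate p' := (Real.holderConjugate_iff_eq_conjExponent hp1).2 hp'
  have hq1 : p' - 1 = 1 / (p - 1) := by rw [hp']; field_simp; ring
  have hq : 2 ≤ p' := by
    rw [hp', le_div_iff₀ hp10]; linarith
  have hr : 1 ≤ 1 / (p - 1) := by rw [le_div_iff₀ hp10]; linarith
  have hpr : p * (1 / (p - 1)) = p' := by rw [hp']; ring
  have hpt : ∀ x, ((‖((1 : ℝ) / 2) • (f x + g x)‖ ^ p) ^ (1 / (p - 1))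
      + (‖((1 : ℝ) / 2) • (f x - g x)‖ ^ p) ^ (1 / (p - 1))) ^ (1 / (1 / (p - 1)))
      ≤ 1 / 2 * ‖f x‖ ^ p + 1 / 2 * ‖g x‖ ^ p := by
    intro x
    rw [← Real.rpow_mul (norm_nonneg _), ← Real.rpow_mul (norm_nonneg _), hpr, one_div (1 / _),
      Real.rpow_inv_le_iff_of_pos (by positivity) (by positivity) (by positivity), ← hq1]
    exact clarkson_norm hpq hq (f x) (g x)
  have hsum : Integrable (fun x ↦ 1 / 2 * ‖f x‖ ^ p + 1 / 2 * ‖g x‖ ^ p) (volume.restrict Ω) :=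
    (hfi.const_mul _).add (hgi.const_mul _)
  have le_root : ∀ a b : ℝ, 0 ≤ a → 0 ≤ b →
      a ≤ (a ^ (1 / (p - 1)) + b ^ (1 / (p - 1))) ^ (1 / (1 / (p - 1))) := by
    intro a b ha hb
    rw [one_div (1 / _), Real.le_rpow_inv_iff_of_pos ha (by positivity) (by positivity)]
    linarith [Real.rpow_nonneg hb (1 / (p - 1))]
  have hφ : Integrable (fun x ↦ ‖((1 : ℝ) / 2) • (f x + g x)‖ ^ p) (volume.restrict Ω) := by
    refine hsum.mono' (Measurable.aestronglyMeasurable (by fun_prop)) (.of_forall fun x ↦ ?_)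
    rw [Real.norm_of_nonneg (by positivity)]
    exact (le_root _ _ (by positivity) (by positivity)).trans (hpt x)
  have hψ : Integrable (fun x ↦ ‖((1 : ℝ) / 2) • (f x - g x)‖ ^ p) (volume.restrict Ω) := by
    refine hsum.mono' (Measurable.aestronglyMeasurable (by fun_prop)) (.of_forall fun x ↦ ?_)
    rw [Real.norm_of_nonneg (by positivity)]
    refine (le_root _ (‖((1 : ℝ) / 2) • (f x + g x)‖ ^ p) (by positivity) (by positivity)).trans ?_
    rw [add_comm (_ ^ (1 / (p - 1)))]
    exact hpt x
  have h := (rpow_integral_add_rpow_integral_le hr hφ hψ (fun x ↦ by positivity)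
    (fun x ↦ by positivity)).trans
    (integral_mono_of_nonneg (.of_forall fun x ↦ by positivity) hsum (.of_forall hpt))
  rw [integral_add (hfi.const_mul _) (hgi.const_mul _), integral_const_mul, integral_const_mul,
    one_div (1 / _), Real.rpow_inv_le_iff_of_pos (by positivity) (by positivity) (by positivity)]
    at h
  have hexp : 1 / p * p' = 1 / (p - 1) := by rw [hp']; field_simp
  have root_pow : ∀ a : ℝ, 0 ≤ a → (a ^ (1 / p)) ^ p = a := fun a ha ↦ by
    rw [one_div, Real.rpow_inv_rpow ha hp0.ne']
  rwa [root_pow _ (by positivity), root_pow _ (by positivity), ← Real.rpow_mul (by positivity),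
    ← Real.rpow_mul (by positivity), hexp]
end

section
/- Let Ω ⊂ ℝ^d be a bounded open set with Lebesgue measure, let 1 < p < ∞, p' = p/(p−1), and m ≥ 1. If f_n, f : Ω → ℝᵐ are measurable with ‖f_n‖_p, ‖f‖_p < ∞ and ‖f_n − f‖_p → 0 as n → ∞, then ∫_Ω | |f_n|^{p−2} f_n − |f|^{p−2} f |^{p'} dx → 0 as n → ∞; that is, the map f ↦ |f|^{p−2} f is sequentially continuous from L^p(Ω; ℝᵐ) to L^{p'}(Ω; ℝᵐ). -/
open MeasureTheory Filter

section PowerMap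

variable {E : Type*} [NormedAddCommGroup E] [NormedSpace ℝ E] {p : ℝ}

lemma norm_norm_rpow_sub_two_smul (hp : 1 < p) (a : E) :
    ‖(‖a‖ ^ (p - 2)) • a‖ = ‖a‖ ^ (p - 1) := by
  rcases eq_or_ne a 0 with rfl | ha
  · simp [Real.zero_rpow (sub_pos.2 hp).ne']
  · have h : 0 < ‖a‖ := norm_pos_iff.2 ha
    rw [norm_smul, Real.norm_of_nonneg (Real.rpow_nonneg h.le _), ← Real.rpow_add_one h.ne']
    congr 1
    ring

lemma continuous_norm_rpow_sub_two_smul (hp : 1 < p) :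
    Continuous fun a : E => (‖a‖ ^ (p - 2)) • a := by
  refine continuous_iff_continuousAt.2 fun a => ?_
  rcases eq_or_ne a 0 with rfl | ha
  · rw [ContinuousAt, smul_zero, tendsto_zero_iff_norm_tendsto_zero]
    simp_rw [norm_norm_rpow_sub_two_smul hp]
    have h : Continuous fun a : E => ‖a‖ ^ (p - 1) :=
      continuous_norm.rpow_const fun _ => Or.inr (sub_pos.2 hp).le
    simpa [Real.zero_rpow (sub_pos.2 hp).ne'] using h.tendsto 0
  · exact (continuousAt_id.norm.rpow_const (Or.inl (norm_ne_zero_iff.2 ha))).smul continuousAt_id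

lemma norm_rpow_sub_two_smul_smul {r : ℝ} (hr : 0 < r) (a : E) :
    (‖r • a‖ ^ (p - 2)) • (r • a) = r ^ (p - 1) • ((‖a‖ ^ (p - 2)) • a) := by
  rw [norm_smul, Real.norm_of_nonneg hr.le, Real.mul_rpow hr.le (norm_nonneg _), smul_smul,
    smul_smul]
  congr 1
  rw [show p - 1 = p - 2 + 1 by ring, Real.rpow_add_one hr.ne']
  ring

/-- Quantitative continuity of the power map at the unit sphere. -/
lemma exists_norm_powerMap_sub_le_of_norm_eq_one [ProperSpace E] (hp : 1 < p) {ε : ℝ}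
    (hε : 0 < ε) : ∃ K : ℝ, 1 ≤ K ∧ ∀ a b : E, ‖b‖ = 1 →
      ‖(‖a‖ ^ (p - 2)) • a - (‖b‖ ^ (p - 2)) • b‖ ≤ ε ∨
      ‖(‖a‖ ^ (p - 2)) • a - (‖b‖ ^ (p - 2)) • b‖ ≤ K * ‖a - b‖ ^ (p - 1) := by
  have hp0 : 0 ≤ p - 1 := (sub_pos.2 hp).le
  have huc := (isCompact_sphere (0 : E) 1).uniformContinuousAt_of_continuousAt
    (fun a : E => (‖a‖ ^ (p - 2)) • a)
    (fun a _ => (continuous_norm_rpow_sub_two_smul hp).continuousAt)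
    (Metric.dist_mem_uniformity hε)
  obtain ⟨δ, hδ, H⟩ := Metric.mem_uniformity_dist.1 huc
  have hδ1 : 1 ≤ 1 + 1 / δ := le_add_of_nonneg_right (by positivity)
  have hone : 1 ≤ (1 + 1 / δ) ^ (p - 1) := Real.one_le_rpow hδ1 hp0
  refine ⟨2 * (1 + 1 / δ) ^ (p - 1), by linarith, fun a b hb => ?_⟩
  rcases lt_or_ge ‖a - b‖ δ with h | h
  · left
    have h1 := @H b a (by rwa [dist_comm, dist_eq_norm])
    have h2 := h1 (by simpa using hb)
    have h3 : dist ((‖b‖ ^ (p - 2)) • b) ((‖a‖ ^ (p - 2)) • a) < ε := h2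
    rw [dist_comm, dist_eq_norm] at h3
    exact h3.le
  · right
    have hle : ‖a‖ ≤ ‖a - b‖ + 1 := by
      have := norm_add_le (a - b) b
      rwa [sub_add_cancel, hb] at this
    have ht : ‖a - b‖ + 1 ≤ (1 + 1 / δ) * ‖a - b‖ := by
      have : 1 ≤ ‖a - b‖ / δ := (one_le_div hδ).2 h
      calc ‖a - b‖ + 1 ≤ ‖a - b‖ + ‖a - b‖ / δ := by linarith
        _ = _ := by ring
    calc _ ≤ ‖(‖a‖ ^ (p - 2)) • a‖ + ‖(‖b‖ ^ (p - 2)) • b‖ := norm_sub_le _ _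
      _ = ‖a‖ ^ (p - 1) + 1 := by
        rw [norm_norm_rpow_sub_two_smul hp, norm_norm_rpow_sub_two_smul hp, hb, Real.one_rpow]
      _ ≤ (‖a - b‖ + 1) ^ (p - 1) + (‖a - b‖ + 1) ^ (p - 1) :=
        add_le_add (Real.rpow_le_rpow (norm_nonneg _) hle hp0)
          (Real.one_le_rpow (by linarith [norm_nonneg (a - b)]) hp0)
      _ = 2 * (‖a - b‖ + 1) ^ (p - 1) := by ring
      _ ≤ 2 * ((1 + 1 / δ) * ‖a - b‖) ^ (p - 1) := by gcongr
      _ = _ := by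
        rw [Real.mul_rpow (by positivity) (norm_nonneg _)]
        ring

lemma exists_norm_powerMap_sub_le [ProperSpace E] (hp : 1 < p) {ε : ℝ} (hε : 0 < ε) :
    ∃ K : ℝ, 1 ≤ K ∧ ∀ a b : E,
      ‖(‖a‖ ^ (p - 2)) • a - (‖b‖ ^ (p - 2)) • b‖ ≤ ε * ‖b‖ ^ (p - 1) ∨
      ‖(‖a‖ ^ (p - 2)) • a - (‖b‖ ^ (p - 2)) • b‖ ≤ K * ‖a - b‖ ^ (p - 1) := by
  obtain ⟨K, hK, H⟩ := exists_norm_powerMap_sub_le_of_norm_eq_one (E := E) hp hε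
  refine ⟨K, hK, fun a b => ?_⟩
  rcases eq_or_ne b 0 with rfl | hb
  · right
    rw [smul_zero, sub_zero, sub_zero, norm_norm_rpow_sub_two_smul hp]
    exact le_mul_of_one_le_left (by positivity) hK
  obtain ⟨r, hr, hrb⟩ : ∃ r : ℝ, 0 < r ∧ ‖b‖ = r := ⟨_, norm_pos_iff.2 hb, rfl⟩
  obtain ⟨a, rfl⟩ : ∃ a', a = r • a' := ⟨r⁻¹ • a, (smul_inv_smul₀ hr.ne' a).symm⟩
  obtain ⟨b, rfl⟩ : ∃ b', b = r • b' := ⟨r⁻¹ • b, (smul_inv_smul₀ hr.ne' b).symm⟩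
  have hb1 : ‖b‖ = 1 := by
    rw [norm_smul, Real.norm_of_nonneg hr.le] at hrb
    exact mul_left_cancel₀ hr.ne' (by rw [hrb, mul_one])
  have hrp : 0 < r ^ (p - 1) := Real.rpow_pos_of_pos hr _
  rw [norm_rpow_sub_two_smul_smul hr, norm_rpow_sub_two_smul_smul hr, ← smul_sub, ← smul_sub,
    norm_smul, Real.norm_of_nonneg hrp.le, hrb, norm_smul r, Real.norm_of_nonneg hr.le,
    Real.mul_rpow hr.le (norm_nonneg _), mul_comm ε, mul_left_comm K]
  exact (H a b hb1).imp (fun h => mul_le_mul_of_nonneg_left h hrp.le)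
    (fun h => mul_le_mul_of_nonneg_left h hrp.le)

lemma exists_norm_powerMap_sub_rpow_le [ProperSpace E] (hp : 1 < p) {ε : ℝ} (hε : 0 < ε) :
    ∃ C : ℝ, ∀ a b : E,
      ‖(‖a‖ ^ (p - 2)) • a - (‖b‖ ^ (p - 2)) • b‖ ^ (p / (p - 1)) ≤
        ε * ‖b‖ ^ p + C * ‖a - b‖ ^ p := by
  have hp1 : 0 < p - 1 := sub_pos.2 hp
  have hq : 0 < p / (p - 1) := div_pos (by linarith) hp1
  obtain ⟨K, hK, H⟩ := exists_norm_powerMap_sub_le (E := E) hp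
    (Real.rpow_pos_of_pos hε (p / (p - 1))⁻¹)
  have hpow (c : ℝ) (hc : 0 ≤ c) (v : E) :
      (c * ‖v‖ ^ (p - 1)) ^ (p / (p - 1)) = c ^ (p / (p - 1)) * ‖v‖ ^ p := by
    rw [Real.mul_rpow hc (by positivity), ← Real.rpow_mul (norm_nonneg _),
      mul_div_cancel₀ _ hp1.ne']
  have hK0 : 0 ≤ K := zero_le_one.trans hK
  refine ⟨K ^ (p / (p - 1)), fun a b => ?_⟩
  rcases H a b with h | h
  · refine (Real.rpow_le_rpow (norm_nonneg _) h hq.le).trans ?_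
    rw [hpow _ (by positivity), Real.rpow_inv_rpow hε.le hq.ne']
    exact le_add_of_nonneg_right (by positivity)
  · refine (Real.rpow_le_rpow (norm_nonneg _) h hq.le).trans ?_
    rw [hpow _ hK0]
    exact le_add_of_nonneg_left (by positivity)

end PowerMap

theorem power_map_sequentially_continuous_Lp_to_Lp'
    (d m : ℕ) (hd : 1 ≤ d) (hm : 1 ≤ m)
    (Ω : Set (EuclideanSpace ℝ (Fin d))) (hΩo : IsOpen Ω) (hΩb : Bornology.IsBounded Ω)
    (p p' : ℝ) (hp1 : 1 < p) (hp' : p' = p / (p - 1))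
    (F : ℕ → EuclideanSpace ℝ (Fin d) → EuclideanSpace ℝ (Fin m))
    (f : EuclideanSpace ℝ (Fin d) → EuclideanSpace ℝ (Fin m))
    (hF : ∀ n, Measurable (F n)) (hf : Measurable f)
    (hFi : ∀ n, Integrable (fun x => ‖F n x‖ ^ p) (volume.restrict Ω))
    (hfi : Integrable (fun x => ‖f x‖ ^ p) (volume.restrict Ω))
    (hconv : Tendsto (fun n => (∫ x in Ω, ‖F n x - f x‖ ^ p) ^ (1 / p)) atTop (nhds 0)) :
    Tendsto
      (fun n => ∫ x in Ω, ‖(‖F n x‖ ^ (p - 2)) • F n x - (‖f x‖ ^ (p - 2)) • f x‖ ^ p')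
      atTop (nhds 0) := by
  subst hp'
  have hp0 : 0 < p := zero_lt_one.trans hp1
  have hpE : ENNReal.ofReal p ≠ 0 := by simpa using hp0
  have memLp_of {g : EuclideanSpace ℝ (Fin d) → EuclideanSpace ℝ (Fin m)} (hg : Measurable g)
      (hgi : Integrable (fun x => ‖g x‖ ^ p) (volume.restrict Ω)) :
      MemLp g (ENNReal.ofReal p) (volume.restrict Ω) := by
    rw [← integrable_norm_rpow_iff hg.aestronglyMeasurable hpE ENNReal.ofReal_ne_top,
      ENNReal.toReal_ofReal hp0.le]
    exact hgi
  have hdi (n : ℕ) : Integrable (fun x => ‖F n x - f x‖ ^ p) (volume.restrict Ω) := by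
    have h := ((memLp_of (hF n) (hFi n)).sub (memLp_of hf hfi)).integrable_norm_rpow hpE
      ENNReal.ofReal_ne_top
    rwa [ENNReal.toReal_ofReal hp0.le] at h
  have hJ : Tendsto (fun n => ∫ x in Ω, ‖F n x - f x‖ ^ p) atTop (nhds 0) := by
    have h := hconv.rpow_const (p := p) (Or.inr hp0.le)
    rw [Real.zero_rpow hp0.ne'] at h
    refine h.congr fun n => ?_
    rw [one_div, Real.rpow_inv_rpow (integral_nonneg fun x => by positivity) hp0.ne']
  have hA : 0 ≤ ∫ x in Ω, ‖f x‖ ^ p := integral_nonneg fun x => by positivity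
  set A := ∫ x in Ω, ‖f x‖ ^ p with hAdef
  refine tendsto_order.2 ⟨fun c hc => Eventually.of_forall fun n =>
    hc.trans_le (integral_nonneg fun x => by positivity), fun c hc => ?_⟩
  have hε : 0 < c / (A + 1) := by positivity
  obtain ⟨C, H⟩ := exists_norm_powerMap_sub_rpow_le (E := EuclideanSpace ℝ (Fin m)) hp1 hε
  have hlim : Tendsto (fun n => c / (A + 1) * A + C * ∫ x in Ω, ‖F n x - f x‖ ^ p) atTop
      (nhds (c / (A + 1) * A)) := by
    simpa using (hJ.const_mul C).const_add (c / (A + 1) * A)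
  have hlt : c / (A + 1) * A < c := by
    rw [div_mul_eq_mul_div, div_lt_iff₀ (by positivity)]
    nlinarith
  filter_upwards [hlim.eventually (gt_mem_nhds hlt)] with n hn
  refine lt_of_le_of_lt ?_ hn
  rw [hAdef, ← integral_const_mul, ← integral_const_mul,
    ← integral_add (hfi.const_mul _) ((hdi n).const_mul _)]
  exact integral_mono_of_nonneg (Eventually.of_forall fun x => by positivity)
    ((hfi.const_mul _).add ((hdi n).const_mul _)) (Eventually.of_forall fun x => H _ _)
end

section
/- Let Ω ⊂ ℝ^d be a bounded open set with Lebesgue measure, let 1 < p < ∞ and m ≥ 1. For all measurable f, g : Ω → ℝᵐ with ‖f‖_p < ∞ and ‖g‖_p < ∞ one has ∫_Ω ( |f|^{p−2} f − |g|^{p−2} g ) · (f − g) dx ≥ ( ‖f‖_p^{p−1} − ‖g‖_p^{p−1} ) ( ‖f‖_p − ‖g‖_p ), where · denotes the Euclidean inner product on ℝᵐ. -/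
open MeasureTheory
open scoped RealInnerProductSpace

theorem rpow_one_div_rpow_sub_one_mul_self {p : ℝ} (hp : 1 < p) {a : ℝ} (ha : 0 ≤ a) :
    (a ^ (1 / p)) ^ (p - 1) * a ^ (1 / p) = a := by
  have hp0 : p ≠ 0 := by linarith
  rw [← Real.rpow_mul ha, ← Real.rpow_add' ha (by field_simp; simpa using hp0),
    show 1 / p * (p - 1) + 1 / p = 1 by field_simp; ring, Real.rpow_one]

section

variable {E : Type*} [NormedAddCommGroup E] {α : Type*} [MeasurableSpace α] {μ : Measure α}
  {p : ℝ} {f g : α → E}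

theorem memLp_ofReal_of_integrable_norm_rpow (hp : 1 < p) (hf : AEStronglyMeasurable f μ)
    (hfi : Integrable (fun x => ‖f x‖ ^ p) μ) : MemLp f (ENNReal.ofReal p) μ := by
  have hp0 : 0 < p := by linarith
  rw [← integrable_norm_rpow_iff hf (by simpa using hp0) ENNReal.ofReal_ne_top,
    ENNReal.toReal_ofReal hp0.le]
  exact hfi

theorem norm_rpow_sub_one_rpow_conjExponent (hp : 1 < p) (v : E) :
    (‖v‖ ^ (p - 1)) ^ p.conjExponent = ‖v‖ ^ p := by
  rw [← Real.rpow_mul (norm_nonneg _), Real.conjExponent,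
    mul_div_cancel₀ p (by linarith : p - 1 ≠ 0)]

theorem memLp_conjExponent_norm_rpow_sub_one (hp : 1 < p) (hf : AEStronglyMeasurable f μ)
    (hfi : Integrable (fun x => ‖f x‖ ^ p) μ) :
    MemLp (fun x => ‖f x‖ ^ (p - 1)) (ENNReal.ofReal p.conjExponent) μ := by
  refine memLp_ofReal_of_integrable_norm_rpow (Real.HolderConjugate.conjExponent hp).symm.lt
    (hf.norm.aemeasurable.pow_const _).aestronglyMeasurable ?_
  refine hfi.congr (.of_forall fun x => ?_)
  simp only
  rw [Real.norm_of_nonneg (by positivity), norm_rpow_sub_one_rpow_conjExponent hp]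

theorem integrable_norm_rpow_sub_one_mul_norm (hp : 1 < p)
    (hf : AEStronglyMeasurable f μ) (hg : AEStronglyMeasurable g μ)
    (hfi : Integrable (fun x => ‖f x‖ ^ p) μ) (hgi : Integrable (fun x => ‖g x‖ ^ p) μ) :
    Integrable (fun x => ‖f x‖ ^ (p - 1) * ‖g x‖) μ := by
  have := (Real.HolderConjugate.conjExponent hp).symm.ennrealOfReal
  exact (memLp_conjExponent_norm_rpow_sub_one hp hf hfi).integrable_mul
    (memLp_ofReal_of_integrable_norm_rpow hp hg hgi).norm

theorem integral_norm_rpow_sub_one_mul_norm_le (hp : 1 < p)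
    (hf : AEStronglyMeasurable f μ) (hg : AEStronglyMeasurable g μ)
    (hfi : Integrable (fun x => ‖f x‖ ^ p) μ) (hgi : Integrable (fun x => ‖g x‖ ^ p) μ) :
    ∫ x, ‖f x‖ ^ (p - 1) * ‖g x‖ ∂μ ≤
      ((∫ x, ‖f x‖ ^ p ∂μ) ^ (1 / p)) ^ (p - 1) * (∫ x, ‖g x‖ ^ p ∂μ) ^ (1 / p) := by
  have h := integral_mul_le_Lp_mul_Lq_of_nonneg (Real.HolderConjugate.conjExponent hp).symm
    (.of_forall fun x => by positivity) (.of_forall fun x => norm_nonneg _)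
    (memLp_conjExponent_norm_rpow_sub_one hp hf hfi)
    (memLp_ofReal_of_integrable_norm_rpow hp hg hgi).norm
  simp only [norm_rpow_sub_one_rpow_conjExponent hp] at h
  rwa [← Real.rpow_mul (integral_nonneg fun x => by positivity),
    show 1 / p * (p - 1) = 1 / p.conjExponent by rw [Real.conjExponent, one_div_div]; ring]

variable [InnerProductSpace ℝ E]

theorem norm_rpow_sub_two_smul (hp : 1 < p) (v : E) :
    ‖(‖v‖ ^ (p - 2)) • v‖ = ‖v‖ ^ (p - 1) := by
  rw [norm_smul, Real.norm_of_nonneg (by positivity)]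
  rcases eq_or_ne v 0 with rfl | hv
  · simp [Real.zero_rpow (by linarith : p - 1 ≠ 0)]
  · rw [← Real.rpow_add_one (norm_ne_zero_iff.mpr hv)]
    ring_nf

theorem inner_norm_rpow_sub_two_smul_self (hp : 1 < p) (v : E) :
    ⟪(‖v‖ ^ (p - 2)) • v, v⟫ = ‖v‖ ^ p := by
  rw [real_inner_smul_left, real_inner_self_eq_norm_sq]
  rcases eq_or_ne v 0 with rfl | hv
  · simp [Real.zero_rpow (by linarith : p ≠ 0)]
  · rw [← Real.rpow_add_natCast (norm_ne_zero_iff.mpr hv)]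
    norm_num

theorem norm_inner_norm_rpow_sub_two_smul_le (hp : 1 < p) (v w : E) :
    ‖⟪(‖v‖ ^ (p - 2)) • v, w⟫‖ ≤ ‖v‖ ^ (p - 1) * ‖w‖ :=
  (norm_inner_le_norm _ _).trans_eq (by rw [norm_rpow_sub_two_smul hp])

theorem integrable_inner_norm_rpow_sub_two_smul (hp : 1 < p)
    (hf : AEStronglyMeasurable f μ) (hg : AEStronglyMeasurable g μ)
    (hfi : Integrable (fun x => ‖f x‖ ^ p) μ) (hgi : Integrable (fun x => ‖g x‖ ^ p) μ) :
    Integrable (fun x => ⟪(‖f x‖ ^ (p - 2)) • f x, g x⟫) μ :=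
  (integrable_norm_rpow_sub_one_mul_norm hp hf hg hfi hgi).mono'
    (((hf.norm.aemeasurable.pow_const _).aestronglyMeasurable.smul hf).inner hg)
    (.of_forall fun _ => norm_inner_norm_rpow_sub_two_smul_le hp _ _)

theorem integral_inner_norm_rpow_sub_two_smul_le (hp : 1 < p)
    (hf : AEStronglyMeasurable f μ) (hg : AEStronglyMeasurable g μ)
    (hfi : Integrable (fun x => ‖f x‖ ^ p) μ) (hgi : Integrable (fun x => ‖g x‖ ^ p) μ) :
    ∫ x, ⟪(‖f x‖ ^ (p - 2)) • f x, g x⟫ ∂μ ≤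
      ((∫ x, ‖f x‖ ^ p ∂μ) ^ (1 / p)) ^ (p - 1) * (∫ x, ‖g x‖ ^ p ∂μ) ^ (1 / p) :=
  (integral_mono (integrable_inner_norm_rpow_sub_two_smul hp hf hg hfi hgi)
    (integrable_norm_rpow_sub_one_mul_norm hp hf hg hfi hgi)
    fun _ => (le_abs_self _).trans (norm_inner_norm_rpow_sub_two_smul_le hp _ _)).trans
    (integral_norm_rpow_sub_one_mul_norm_le hp hf hg hfi hgi)

end

theorem integral_monotonicity_lower_bound
    (d m : ℕ) (hd : 1 ≤ d) (hm : 1 ≤ m)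
    (Ω : Set (EuclideanSpace ℝ (Fin d))) (hΩo : IsOpen Ω) (hΩb : Bornology.IsBounded Ω)
    (p : ℝ) (hp : 1 < p)
    (f g : EuclideanSpace ℝ (Fin d) → EuclideanSpace ℝ (Fin m))
    (hf : Measurable f) (hg : Measurable g)
    (hfi : Integrable (fun x => ‖f x‖ ^ p) (volume.restrict Ω))
    (hgi : Integrable (fun x => ‖g x‖ ^ p) (volume.restrict Ω)) :
    (∫ x in Ω, ⟪(‖f x‖ ^ (p - 2)) • f x - (‖g x‖ ^ (p - 2)) • g x, f x - g x⟫)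
      ≥ (((∫ x in Ω, ‖f x‖ ^ p) ^ (1 / p)) ^ (p - 1)
            - ((∫ x in Ω, ‖g x‖ ^ p) ^ (1 / p)) ^ (p - 1))
          * ((∫ x in Ω, ‖f x‖ ^ p) ^ (1 / p) - (∫ x in Ω, ‖g x‖ ^ p) ^ (1 / p)) := by
  have hf' : AEStronglyMeasurable f (volume.restrict Ω) := hf.aestronglyMeasurable
  have hg' : AEStronglyMeasurable g (volume.restrict Ω) := hg.aestronglyMeasurable
  have hfg := integrable_inner_norm_rpow_sub_two_smul hp hf' hg' hfi hgi
  have hgf := integrable_inner_norm_rpow_sub_two_smul hp hg' hf' hgi hfi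
  have expand : (∫ x in Ω, ⟪(‖f x‖ ^ (p - 2)) • f x - (‖g x‖ ^ (p - 2)) • g x, f x - g x⟫) =
      ((∫ x in Ω, ‖f x‖ ^ p) - ∫ x in Ω, ⟪(‖f x‖ ^ (p - 2)) • f x, g x⟫) -
        ((∫ x in Ω, ⟪(‖g x‖ ^ (p - 2)) • g x, f x⟫) - ∫ x in Ω, ‖g x‖ ^ p) := by
    rw [← integral_sub' hfi hfg, ← integral_sub' hgf hgi,
      ← integral_sub (hfi.sub hfg) (hgf.sub hgi)]
    refine integral_congr_ae (.of_forall fun x => ?_)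
    simp only [Pi.sub_apply, inner_sub_left, inner_sub_right, inner_norm_rpow_sub_two_smul_self hp]
    ring
  have holder_fg := integral_inner_norm_rpow_sub_two_smul_le hp hf' hg' hfi hgi
  have holder_gf := integral_inner_norm_rpow_sub_two_smul_le hp hg' hf' hgi hfi
  have hF := rpow_one_div_rpow_sub_one_mul_self hp
    (integral_nonneg (μ := volume.restrict Ω) fun x => Real.rpow_nonneg (norm_nonneg (f x)) p)
  have hG := rpow_one_div_rpow_sub_one_mul_self hp
    (integral_nonneg (μ := volume.restrict Ω) fun x => Real.rpow_nonneg (norm_nonneg (g x)) p)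
  rw [expand, ge_iff_le, sub_mul, mul_sub, mul_sub, hF, hG]
  linarith
end
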